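/- Let y be an odd positive integer that is not a Zumkeller number. Then Ulam[y] = Ulam[y−1]. -/

import Mathlib

/-- Fuel-indexed Ulam predicate: a binary word (as a `List Bool`) of length 1 is Ulam,
and a longer word is Ulam iff it is expressible *uniquely* as a concatenation of two
distinct (nonempty) Ulam words. The fuel strictly exceeds the lengths needed. -/
def ulamAux : ℕ → List Bool → Prop
  | 0, _ => False
  | n + 1, w =>
    if w.length = 1 then True
    else ∃! p : List Bool × List Bool,
      p.1 ≠ [] ∧ p.2 ≠ [] ∧ p.1 ≠ p.2 ∧ w = p.1 ++ p.2 ∧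
        ulamAux n p.1 ∧ ulamAux n p.2

/-- A binary word is an Ulam word. -/
def IsUlam (w : List Bool) : Prop := ulamAux w.length w

/-- The word `0^x 1 0^y`. -/
def wordTwo (x y : ℕ) : List Bool :=
  List.replicate x false ++ [true] ++ List.replicate y false

/-- The word `0^x 1 0^y 1 0^z`. -/
def wordThree (x y z : ℕ) : List Bool :=
  List.replicate x false ++ [true] ++ List.replicate y false ++ [true] ++
    List.replicate z false

/-- `UlamSet y` is the set of pairs `(x,z)` such that `0^x 1 0^y 1 0^z` is Ulam. -/
def UlamSet (y : ℕ) : Set (ℕ × ℕ) := {p | IsUlam (wordThree p.1 y p.2)}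

/-- `culam y x z = min(2, N)` where `N` counts `0 ≤ a ≤ y` with both
`w(x,a)` and `w(y-a,z)` Ulam. -/
noncomputable def culam (y x z : ℕ) : ℕ :=
  min 2 {a : ℕ | a ≤ y ∧ IsUlam (wordTwo x a) ∧ IsUlam (wordTwo (y - a) z)}.ncard

/-- A positive integer is Zumkeller if its binary representation has at most one `0`. -/
def IsZumkeller (y : ℕ) : Prop := 0 < y ∧ (Nat.bits y).count false ≤ 1

/-- The largest `e ≤ d - 1` with `x mod 2^(e+1) < 2^e` and `z mod 2^(e+1) < 2^e`
(and `0` if none exists). -/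
def eIdx (d x z : ℕ) : ℕ :=
  Nat.findGreatest (fun e => x % 2 ^ (e + 1) < 2 ^ e ∧ z % 2 ^ (e + 1) < 2 ^ e) (d - 1)

/-- The universal pattern `E1[d]` on `B_d`. -/
def E1 (d x z : ℕ) : ℕ :=
  if 2 ^ d - 1 ≤ x + z then 0
  else if x % 2 ^ eIdx d x z + z % 2 ^ eIdx d x z < 2 ^ eIdx d x z - 1 then 2 else 1

/-- The universal pattern `E2[d]` on `B_d` (constant `1`). -/
def E2 (_d _x _z : ℕ) : ℕ := 1

/-- The universal pattern `O1[d]` on `B_d`. -/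
def O1 (d x z : ℕ) : ℕ :=
  if 2 ^ d - 2 ≤ x + z then 0
  else if (x + z) % 2 = 0 then (if x % 2 = 1 then 0 else 2)
  else if x % 2 ^ eIdx d x z + z % 2 ^ eIdx d x z < 2 ^ eIdx d x z - 1 then 2 else 1

/-- The universal pattern `O2[d]` on `B_d` (independent of `d`). -/
def O2 (_d x z : ℕ) : ℕ :=
  if (x + z) % 2 = 0 then (if x % 2 = 1 then 0 else 2) else 1

/-- The parity of `(x + y).choose x`. -/
def choosePar (x y : ℕ) : ℕ := (x + y).choose x % 2

theorem choosePar_le_one (x y : ℕ) : choosePar x y ≤ 1 := by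
  unfold choosePar; omega

theorem choosePar_zero_left (y : ℕ) : choosePar 0 y = 1 := by simp [choosePar]

theorem choosePar_zero_right (x : ℕ) : choosePar x 0 = 1 := by simp [choosePar]

theorem choosePar_succ_succ (x y : ℕ) :
    choosePar (x + 1) (y + 1) = (choosePar x (y + 1) + choosePar (x + 1) y) % 2 := by
  unfold choosePar
  have h1 : x + 1 + (y + 1) = (x + y + 1) + 1 := by ring
  have h2 : x + (y + 1) = x + y + 1 := by ring
  have h3 : x + 1 + y = x + y + 1 := by ring
  rw [h1, h2, h3, Nat.choose_succ_succ, Nat.add_mod]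

theorem choose_mod_two (n k : ℕ) :
    n.choose k % 2 = ((n % 2).choose (k % 2) * (n / 2).choose (k / 2)) % 2 :=
  haveI : Fact (Nat.Prime 2) := ⟨Nat.prime_two⟩
  Choose.choose_modEq_choose_mod_mul_choose_div_nat (n := n) (k := k) (p := 2)

theorem choosePar_even_even (x y : ℕ) : choosePar (2 * x) (2 * y) = choosePar x y := by
  unfold choosePar
  rw [choose_mod_two, show (2 * x + 2 * y) % 2 = 0 by omega, show 2 * x % 2 = 0 by omega,
    show (2 * x + 2 * y) / 2 = x + y by omega, show 2 * x / 2 = x by omega]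
  simp

theorem choosePar_odd_even (x y : ℕ) : choosePar (2 * x + 1) (2 * y) = choosePar x y := by
  unfold choosePar
  rw [choose_mod_two, show (2 * x + 1 + 2 * y) % 2 = 1 by omega,
    show (2 * x + 1) % 2 = 1 by omega,
    show (2 * x + 1 + 2 * y) / 2 = x + y by omega, show (2 * x + 1) / 2 = x by omega]
  simp

theorem choosePar_even_odd (x y : ℕ) : choosePar (2 * x) (2 * y + 1) = choosePar x y := by
  unfold choosePar
  rw [choose_mod_two, show (2 * x + (2 * y + 1)) % 2 = 1 by omega,
    show 2 * x % 2 = 0 by omega,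
    show (2 * x + (2 * y + 1)) / 2 = x + y by omega, show 2 * x / 2 = x by omega]
  simp

theorem choosePar_odd_odd (x y : ℕ) : choosePar (2 * x + 1) (2 * y + 1) = 0 := by
  unfold choosePar
  rw [choose_mod_two, show (2 * x + 1 + (2 * y + 1)) % 2 = 0 by omega,
    show (2 * x + 1) % 2 = 1 by omega]
  simp

/-- The number of `a ≤ h` such that both `(x + a).choose x` and `(h - a + z).choose z` are odd. -/
def numSplits (h x z : ℕ) : ℕ :=
  ∑ a ∈ Finset.range (h + 1), choosePar x a * choosePar (h - a) z

theorem sum_range_two_mul (g : ℕ → ℕ) (n : ℕ) :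
    ∑ i ∈ Finset.range (2 * n), g i = ∑ i ∈ Finset.range n, (g (2 * i) + g (2 * i + 1)) := by
  induction n with
  | zero => simp
  | succ n ih =>
    rw [show 2 * (n + 1) = 2 * n + 1 + 1 by ring, Finset.sum_range_succ, Finset.sum_range_succ,
      Finset.sum_range_succ, ih, add_assoc]

theorem numSplits_odd (h x z : ℕ) :
    numSplits (2 * h + 1) x z =
      ∑ a ∈ Finset.range (h + 1), (choosePar x (2 * a) * choosePar (2 * (h - a) + 1) z +
        choosePar x (2 * a + 1) * choosePar (2 * (h - a)) z) := by
  unfold numSplits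
  rw [show 2 * h + 1 + 1 = 2 * (h + 1) by ring, sum_range_two_mul]
  refine Finset.sum_congr rfl fun a ha => ?_
  have : a ≤ h := by simpa [Nat.lt_succ_iff] using ha
  rw [show 2 * h + 1 - 2 * a = 2 * (h - a) + 1 by omega,
    show 2 * h + 1 - (2 * a + 1) = 2 * (h - a) by omega]

theorem numSplits_even_succ (h x z : ℕ) :
    numSplits (2 * (h + 1)) x z =
      ∑ a ∈ Finset.range (h + 2), choosePar x (2 * a) * choosePar (2 * (h + 1 - a)) z +
      ∑ a ∈ Finset.range (h + 1), choosePar x (2 * a + 1) * choosePar (2 * (h - a) + 1) z := by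
  unfold numSplits
  rw [Finset.sum_range_succ, sum_range_two_mul, Finset.sum_add_distrib,
    Finset.sum_range_succ _ (h + 1)]
  have h1 : ∑ a ∈ Finset.range (h + 1), choosePar x (2 * a) * choosePar (2 * (h + 1) - 2 * a) z =
      ∑ a ∈ Finset.range (h + 1), choosePar x (2 * a) * choosePar (2 * (h + 1 - a)) z := by
    refine Finset.sum_congr rfl fun a _ => ?_
    rw [show 2 * (h + 1) - 2 * a = 2 * (h + 1 - a) by omega]
  have h2 : ∑ a ∈ Finset.range (h + 1),
        choosePar x (2 * a + 1) * choosePar (2 * (h + 1) - (2 * a + 1)) z =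
      ∑ a ∈ Finset.range (h + 1), choosePar x (2 * a + 1) * choosePar (2 * (h - a) + 1) z := by
    refine Finset.sum_congr rfl fun a ha => ?_
    have : a ≤ h := by simpa [Nat.lt_succ_iff] using ha
    rw [show 2 * (h + 1) - (2 * a + 1) = 2 * (h - a) + 1 by omega]
  rw [h1, h2]
  simp only [Nat.sub_self, Nat.mul_zero]
  ring

theorem numSplits_zero (x z : ℕ) : numSplits 0 x z = 1 := by
  simp [numSplits, choosePar_zero_left, choosePar_zero_right]

theorem numSplits_odd_even_even (h x z : ℕ) :
    numSplits (2 * h + 1) (2 * x) (2 * z) = 2 * numSplits h x z := by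
  rw [numSplits_odd, numSplits, Finset.mul_sum]
  simp only [choosePar_even_even, choosePar_odd_even, choosePar_even_odd, ← two_mul]

theorem numSplits_odd_odd_even (h x z : ℕ) :
    numSplits (2 * h + 1) (2 * x + 1) (2 * z) = numSplits h x z := by
  rw [numSplits_odd, numSplits]
  simp [choosePar_odd_even, choosePar_odd_odd]

theorem numSplits_odd_even_odd (h x z : ℕ) :
    numSplits (2 * h + 1) (2 * x) (2 * z + 1) = numSplits h x z := by
  rw [numSplits_odd, numSplits]
  simp [choosePar_even_odd, choosePar_odd_odd]

theorem numSplits_odd_odd_odd (h x z : ℕ) :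
    numSplits (2 * h + 1) (2 * x + 1) (2 * z + 1) = 0 := by
  rw [numSplits_odd]
  simp [choosePar_odd_odd]

theorem numSplits_even_even_even (h x z : ℕ) :
    numSplits (2 * (h + 1)) (2 * x) (2 * z) = numSplits (h + 1) x z + numSplits h x z := by
  rw [numSplits_even_succ, numSplits, numSplits]
  simp only [choosePar_even_even, choosePar_odd_even, choosePar_even_odd]

theorem numSplits_even_odd_even (h x z : ℕ) :
    numSplits (2 * h) (2 * x + 1) (2 * z) = numSplits h x z := by
  cases h with
  | zero => simp [numSplits_zero]
  | succ h =>
    rw [numSplits_even_succ, numSplits]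
    simp [choosePar_odd_even, choosePar_odd_odd, choosePar_even_even]

theorem numSplits_even_even_odd (h x z : ℕ) :
    numSplits (2 * h) (2 * x) (2 * z + 1) = numSplits h x z := by
  cases h with
  | zero => simp [numSplits_zero]
  | succ h =>
    rw [numSplits_even_succ, numSplits]
    simp [choosePar_even_odd, choosePar_odd_odd, choosePar_even_even]

theorem numSplits_even_odd_odd (h x z : ℕ) :
    numSplits (2 * h) (2 * x + 1) (2 * z + 1) = numSplits h x z := by
  cases h with
  | zero => simp [numSplits_zero]
  | succ h =>
    rw [numSplits_even_succ, numSplits]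
    simp [choosePar_even_odd, choosePar_odd_odd, choosePar_odd_even]

theorem numSplits_zero_left_pos (h z : ℕ) : 0 < numSplits h 0 z := by
  unfold numSplits
  refine Finset.sum_pos' (fun _ _ => Nat.zero_le _) ⟨h, by simp, ?_⟩
  simp [choosePar_zero_left]

theorem numSplits_zero_right_pos (h x : ℕ) : 0 < numSplits h x 0 := by
  unfold numSplits
  refine Finset.sum_pos' (fun _ _ => Nat.zero_le _) ⟨0, by simp, ?_⟩
  simp [choosePar_zero_right]

/-- Where the number of splits vanishes, decreasing `h`, `x` or `z` has the same effect. -/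
theorem numSplits_pred_of_eq_zero (k : ℕ) : ∀ x z : ℕ, numSplits (k + 1) (x + 1) (z + 1) = 0 →
    numSplits k (x + 1) (z + 1) = numSplits (k + 1) x (z + 1) ∧
    numSplits k (x + 1) (z + 1) = numSplits (k + 1) (x + 1) z := by
  induction k using Nat.strong_induction_on with
  | _ k ih =>
  intro x z h0
  have pos : ∀ j a b : ℕ, numSplits j a b = 0 →
      ∃ j' a' b', j = j' + 1 ∧ a = a' + 1 ∧ b = b' + 1 := by
    intro j a b h
    have h1 : j ≠ 0 := by rintro rfl; simp [numSplits_zero] at h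
    have h2 : a ≠ 0 := by rintro rfl; have := numSplits_zero_left_pos j b; omega
    have h3 : b ≠ 0 := by rintro rfl; have := numSplits_zero_right_pos j a; omega
    exact ⟨j - 1, a - 1, b - 1, by omega, by omega, by omega⟩
  obtain ⟨j, rfl | rfl⟩ : ∃ j, k = 2 * j ∨ k = 2 * j + 1 := ⟨k / 2, by omega⟩ <;>
  obtain ⟨a, rfl | rfl⟩ : ∃ a, x = 2 * a ∨ x = 2 * a + 1 := ⟨x / 2, by omega⟩ <;>
  obtain ⟨b, rfl | rfl⟩ : ∃ b, z = 2 * b ∨ z = 2 * b + 1 := ⟨z / 2, by omega⟩ <;>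
  simp only [show ∀ n, 2 * n + 1 + 1 = 2 * (n + 1) from fun n => rfl,
    numSplits_odd_even_even, numSplits_odd_odd_even, numSplits_odd_even_odd,
    numSplits_odd_odd_odd, numSplits_even_even_even, numSplits_even_odd_even,
    numSplits_even_even_odd, numSplits_even_odd_odd] at h0 ⊢
  · simp
  · obtain ⟨j, a, b', rfl, rfl, -⟩ := pos _ _ _ h0
    simp [h0]
  · obtain ⟨j, a', b, rfl, -, rfl⟩ := pos _ _ _ h0
    simp [h0]
  · have h1 : numSplits j (a + 1) (b + 1) = 0 := by omega
    obtain ⟨j, -, -, rfl, -, -⟩ := pos _ _ _ h1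
    rw [numSplits_even_even_even, h1, zero_add]
    exact ih j (by omega) a b h1
  · simp [h0]
  · obtain ⟨a', rfl⟩ : ∃ a', a = a' + 1 := by
      obtain ⟨-, a', -, -, e, -⟩ := pos _ _ _ h0; exact ⟨a', e⟩
    have := ih j (by omega) a' b h0
    simp only [h0, zero_add, true_and]
    exact this.2
  · obtain ⟨b', rfl⟩ : ∃ b', b = b' + 1 := by
      obtain ⟨-, -, b', -, -, e⟩ := pos _ _ _ h0; exact ⟨b', e⟩
    have := ih j (by omega) a b' h0
    simp only [h0, zero_add, and_true]
    exact this.1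
  · have h1 : numSplits (j + 1) (a + 1) (b + 1) = 0 := by omega
    have := ih j (by omega) a b h1
    omega

theorem numSplits_eq_one_of_pred_eq_zero (k : ℕ) : ∀ x z : ℕ,
    numSplits (k + 1) (x + 1) (z + 1) = 1 → numSplits k (x + 1) (z + 1) = 0 →
    numSplits (k + 1) x (z + 1) = 1 ∨ numSplits (k + 1) (x + 1) z = 1 := by
  induction k using Nat.strong_induction_on with
  | _ k ih =>
  intro x z h1 h0
  have hk : k ≠ 0 := by rintro rfl; simp [numSplits_zero] at h0
  obtain ⟨j, rfl | rfl⟩ : ∃ j, k = 2 * j ∨ k = 2 * j + 1 := ⟨k / 2, by omega⟩ <;>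
  obtain ⟨a, rfl | rfl⟩ : ∃ a, x = 2 * a ∨ x = 2 * a + 1 := ⟨x / 2, by omega⟩ <;>
  obtain ⟨b, rfl | rfl⟩ : ∃ b, z = 2 * b ∨ z = 2 * b + 1 := ⟨z / 2, by omega⟩ <;>
  simp only [show ∀ n, 2 * n + 1 + 1 = 2 * (n + 1) from fun n => rfl,
    numSplits_odd_even_even, numSplits_odd_odd_even, numSplits_odd_even_odd,
    numSplits_odd_odd_odd, numSplits_even_even_even, numSplits_even_odd_even,
    numSplits_even_even_odd, numSplits_even_odd_odd] at h0 h1 ⊢ <;>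
  first
  | omega
  | exact ih j (by omega) a b (by omega) (by omega)

theorem numSplits_pred_pos (h : ℕ) : ∀ x z : ℕ, x + z = h + 1 → choosePar x z = 1 →
    (∀ x z, x + z ≤ h → choosePar x z = 1 → 0 < numSplits (x + z) x z) →
    0 < numSplits h x z := by
  induction h using Nat.strong_induction_on with
  | _ h ih =>
  intro x z hxz hc hpos
  obtain ⟨a, rfl | rfl⟩ : ∃ a, x = 2 * a ∨ x = 2 * a + 1 := ⟨x / 2, by omega⟩ <;>
  obtain ⟨b, rfl | rfl⟩ : ∃ b, z = 2 * b ∨ z = 2 * b + 1 := ⟨z / 2, by omega⟩ <;>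
  simp only [choosePar_even_even, choosePar_odd_even, choosePar_even_odd,
    choosePar_odd_odd] at hc
  · obtain ⟨k, rfl⟩ : ∃ k, h = 2 * k + 1 := ⟨a + b - 1, by omega⟩
    rw [numSplits_odd_even_even]
    have := ih k (by omega) a b (by omega) hc fun x z hl => hpos x z (by omega)
    omega
  · obtain rfl : h = 2 * (a + b) := by omega
    rw [numSplits_even_even_odd]
    exact hpos a b (by omega) hc
  · obtain rfl : h = 2 * (a + b) := by omega
    rw [numSplits_even_odd_even]
    exact hpos a b (by omega) hc
  · omega

theorem numSplits_add_pos (x z : ℕ) (hc : choosePar x z = 1) : 0 < numSplits (x + z) x z := by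
  unfold numSplits
  refine Finset.sum_pos' (fun _ _ => Nat.zero_le _) ⟨z, by simp, ?_⟩
  simp [hc]

theorem count_false_bits_lt_numSplits (y : ℕ) : ∀ x z : ℕ, x + z = y → choosePar x z = 1 →
    (Nat.bits y).count false < numSplits y x z := by
  induction y using Nat.strong_induction_on with
  | _ y ih =>
  intro x z hxz hc
  rcases Nat.eq_zero_or_pos y with rfl | hy
  · simp [numSplits_zero]
  obtain ⟨a, rfl | rfl⟩ : ∃ a, x = 2 * a ∨ x = 2 * a + 1 := ⟨x / 2, by omega⟩ <;>
  obtain ⟨b, rfl | rfl⟩ : ∃ b, z = 2 * b ∨ z = 2 * b + 1 := ⟨z / 2, by omega⟩ <;>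
  simp only [choosePar_even_even, choosePar_odd_even, choosePar_even_odd,
    choosePar_odd_odd] at hc
  · obtain ⟨k, rfl⟩ : ∃ k, y = 2 * (k + 1) := ⟨a + b - 1, by omega⟩
    rw [numSplits_even_even_even, Nat.bit0_bits _ (by omega), List.count_cons_self]
    have h1 := ih (k + 1) (by omega) a b (by omega) hc
    have h2 := numSplits_pred_pos k a b (by omega) hc fun x z _ => numSplits_add_pos x z
    omega
  · obtain rfl : y = 2 * (a + b) + 1 := by omega
    rw [numSplits_odd_even_odd, Nat.bit1_bits, List.count_cons_of_ne (by simp)]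
    exact ih _ (by omega) a b rfl hc
  · obtain rfl : y = 2 * (a + b) + 1 := by omega
    rw [numSplits_odd_odd_even, Nat.bit1_bits, List.count_cons_of_ne (by simp)]
    exact ih _ (by omega) a b rfl hc
  · omega

theorem not_ulamAux_nil (n : ℕ) : ¬ ulamAux n [] := by
  cases n with
  | zero => simp [ulamAux]
  | succ n =>
    simp only [ulamAux, List.length_nil, zero_ne_one, if_false]
    rintro ⟨p, ⟨h1, -, -, h2, -⟩, -⟩
    exact h1 (List.append_eq_nil_iff.1 h2.symm).1

theorem ulamAux_eq_of_le (n : ℕ) : ∀ (m : ℕ) (w : List Bool), w.length ≤ n → w.length ≤ m →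
    (ulamAux n w ↔ ulamAux m w) := by
  induction n with
  | zero =>
    intro m w hn _
    obtain rfl : w = [] := List.length_eq_zero_iff.1 (by omega)
    simp [not_ulamAux_nil]
  | succ n ih =>
    intro m w hn hm
    cases m with
    | zero =>
      obtain rfl : w = [] := List.length_eq_zero_iff.1 (by omega)
      simp [not_ulamAux_nil]
    | succ m =>
      simp only [ulamAux]
      split_ifs
      · rfl
      · refine existsUnique_congr fun p => ?_
        refine and_congr_right fun h1 => and_congr_right fun h2 => and_congr_right fun _ =>
          and_congr_right fun h3 => ?_
        have l1 := List.length_pos_iff.2 h1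
        have l2 := List.length_pos_iff.2 h2
        have l3 := congrArg List.length h3
        rw [List.length_append] at l3
        rw [ih m p.1 (by omega) (by omega), ih m p.2 (by omega) (by omega)]

theorem isUlam_singleton (b : Bool) : IsUlam [b] := by simp [IsUlam, ulamAux]

theorem isUlam_iff_existsUnique_pair (w : List Bool) (hw : w.length ≠ 1) :
    IsUlam w ↔ ∃! p : List Bool × List Bool,
      p.1 ≠ [] ∧ p.2 ≠ [] ∧ p.1 ≠ p.2 ∧ w = p.1 ++ p.2 ∧ IsUlam p.1 ∧ IsUlam p.2 := by
  unfold IsUlam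
  rw [ulamAux_eq_of_le w.length (w.length + 1) w le_rfl (Nat.le_succ _)]
  simp only [ulamAux, hw, if_false]
  refine existsUnique_congr fun p => ?_
  refine and_congr_right fun h1 => and_congr_right fun h2 => and_congr_right fun _ =>
    and_congr_right fun h3 => ?_
  have l3 := congrArg List.length h3
  rw [List.length_append] at l3
  rw [ulamAux_eq_of_le w.length p.1.length p.1 (by omega) le_rfl,
    ulamAux_eq_of_le w.length p.2.length p.2 (by omega) le_rfl]

open Classical in
/-- The indicator function of the set of Ulam words. -/
noncomputable def ulamInd (w : List Bool) : ℕ := if IsUlam w then 1 else 0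

theorem ulamInd_eq_one_iff (w : List Bool) : ulamInd w = 1 ↔ IsUlam w := by
  unfold ulamInd; split_ifs <;> simp [*]

/-- The indicator of `uv` being an admissible decomposition into distinct Ulam words. -/
noncomputable def pairInd (u v : List Bool) : ℕ :=
  if u = v then 0 else ulamInd u * ulamInd v

theorem pairInd_eq_ite (u v : List Bool) [Decidable (u ≠ v ∧ IsUlam u ∧ IsUlam v)] :
    pairInd u v = if u ≠ v ∧ IsUlam u ∧ IsUlam v then 1 else 0 := by
  unfold pairInd ulamInd
  split_ifs <;> simp_all

theorem isUlam_iff_sum_pairInd (w : List Bool) (n : ℕ) (hw : w.length = n + 1) (hn : n ≠ 0) :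
    IsUlam w ↔ ∑ i ∈ Finset.range n, pairInd (w.take (i + 1)) (w.drop (i + 1)) = 1 := by
  classical
  simp only [pairInd_eq_ite]
  rw [Finset.sum_boole, Nat.cast_id, Finset.card_eq_one_iff_existsUnique,
    isUlam_iff_existsUnique_pair w (by omega)]
  constructor
  · rintro ⟨⟨u, v⟩, ⟨h1, h2, h3, rfl, h4, h5⟩, huniq⟩
    have l1 := List.length_pos_iff.2 h1
    have l2 := List.length_pos_iff.2 h2
    simp only [List.length_append] at hw l1 l2
    have e : u.length - 1 + 1 = u.length := by omega
    refine ⟨u.length - 1, ?_, ?_⟩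
    · simp only [Finset.mem_filter, Finset.mem_range, e]
      simp only [List.take_left, List.drop_left]
      exact ⟨by omega, h3, h4, h5⟩
    · intro i hi
      simp only [Finset.mem_filter, Finset.mem_range] at hi
      obtain ⟨hin, hne, hu, hv⟩ := hi
      have := huniq ((u ++ v).take (i + 1), (u ++ v).drop (i + 1)) ⟨?_, ?_, hne, ?_, hu, hv⟩
      · have := congrArg (fun p => p.1.length) this
        simp only [List.length_take, List.length_append] at this
        omega
      · rw [← List.length_pos_iff, List.length_take, List.length_append]; omega
      · rw [← List.length_pos_iff, List.length_drop, List.length_append]; omega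
      · rw [List.take_append_drop]
  · rintro ⟨i, hi, huniq⟩
    simp only [Finset.mem_filter, Finset.mem_range] at hi huniq
    obtain ⟨hin, hne, hu, hv⟩ := hi
    refine ⟨(w.take (i + 1), w.drop (i + 1)), ⟨?_, ?_, hne, ?_, hu, hv⟩, ?_⟩
    · rw [← List.length_pos_iff, List.length_take]; omega
    · rw [← List.length_pos_iff, List.length_drop]; omega
    · rw [List.take_append_drop]
    · rintro ⟨u, v⟩ ⟨h1, h2, h3, rfl, h4, h5⟩
      have l1 := List.length_pos_iff.2 h1
      have l2 := List.length_pos_iff.2 h2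
      simp only [List.length_append] at hw l1 l2
      have e : u.length - 1 + 1 = u.length := by omega
      have := huniq (u.length - 1) (by
        simp only [e, List.take_left, List.drop_left]
        exact ⟨by omega, h3, h4, h5⟩)
      rw [← this, e, List.take_left, List.drop_left]

theorem ulamInd_eq_ite_sum (w : List Bool) (n : ℕ) (hw : w.length = n + 1) (hn : n ≠ 0) :
    ulamInd w =
      if ∑ i ∈ Finset.range n, pairInd (w.take (i + 1)) (w.drop (i + 1)) = 1 then 1 else 0 := by
  unfold ulamInd
  simp only [isUlam_iff_sum_pairInd w n hw hn]

theorem pairInd_take_drop {w u v : List Bool} {i : ℕ} (hw : w = u ++ v) (hi : u.length = i) :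
    pairInd (w.take i) (w.drop i) = pairInd u v := by
  subst hi hw
  rw [List.take_left, List.drop_left]

theorem ulamInd_replicate_false (n : ℕ) :
    ulamInd (List.replicate n false) = if n = 1 then 1 else 0 := by
  induction n using Nat.strong_induction_on with
  | _ n ih =>
  match n with
  | 0 => simp [ulamInd, IsUlam, not_ulamAux_nil]
  | 1 => simp [ulamInd, isUlam_singleton]
  | n + 2 =>
    rw [ulamInd_eq_ite_sum _ (n + 1) (by simp) (by omega), Finset.sum_eq_zero]
    · simp
    · intro i hi
      have hi : i < n + 1 := by simpa using hi
      rw [pairInd_take_drop (u := List.replicate (i + 1) false)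
        (v := List.replicate (n + 2 - (i + 1)) false)
        (by rw [List.replicate_append_replicate]; congr 1; omega) (by simp), pairInd,
        ih _ (by omega), ih _ (by omega)]
      split_ifs with h1 h2 h3 <;> try rfl
      exact absurd (by congr 1; omega) h1

theorem sum_pairInd_replicate_left (x : ℕ) (r : List Bool) (hr : true ∈ r) :
    ∑ i ∈ Finset.range x, pairInd ((List.replicate x false ++ r).take (i + 1))
      ((List.replicate x false ++ r).drop (i + 1)) =
      if x = 0 then 0 else ulamInd (List.replicate (x - 1) false ++ r) := by
  cases x with
  | zero => simp
  | succ x =>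
    have key : ∀ i ∈ Finset.range (x + 1),
        pairInd ((List.replicate (x + 1) false ++ r).take (i + 1))
          ((List.replicate (x + 1) false ++ r).drop (i + 1)) =
        if i = 0 then ulamInd (List.replicate x false ++ r) else 0 := by
      intro i hi
      have hi : i < x + 1 := by simpa using hi
      rw [pairInd_take_drop (u := List.replicate (i + 1) false)
        (v := List.replicate (x - i) false ++ r)
        (by rw [← List.append_assoc, List.replicate_append_replicate]; congr 2; omega) (by simp),
        pairInd, ulamInd_replicate_false, if_neg]
      · rcases i with _ | i <;> simp
      · intro h
        have : true ∈ List.replicate (i + 1) false := by rw [h]; simp [hr]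
        simp at this
    rw [Finset.sum_congr rfl key]
    simp

theorem sum_pairInd_replicate_right (z k : ℕ) (l : List Bool) (hl : true ∈ l)
    (hk : l.length = k + 1) :
    ∑ i ∈ Finset.range z, pairInd ((l ++ List.replicate z false).take (k + i + 1))
      ((l ++ List.replicate z false).drop (k + i + 1)) =
      if z = 0 then 0 else ulamInd (l ++ List.replicate (z - 1) false) := by
  cases z with
  | zero => simp
  | succ z =>
    have key : ∀ i ∈ Finset.range (z + 1),
        pairInd ((l ++ List.replicate (z + 1) false).take (k + i + 1))
          ((l ++ List.replicate (z + 1) false).drop (k + i + 1)) =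
        if i = z then ulamInd (l ++ List.replicate z false) else 0 := by
      intro i hi
      have hi : i < z + 1 := by simpa using hi
      rw [pairInd_take_drop (u := l ++ List.replicate i false)
        (v := List.replicate (z + 1 - i) false)
        (by rw [List.append_assoc, List.replicate_append_replicate]; congr 2; omega)
        (by simp; omega),
        pairInd, ulamInd_replicate_false, if_neg]
      · by_cases h : i = z
        · subst h; simp
        · rw [if_neg (by omega), if_neg h, mul_zero]
      · intro h
        have : true ∈ List.replicate (z + 1 - i) false := by rw [← h]; simp [hl]
        simp at this
    rw [Finset.sum_congr rfl key]
    simp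

theorem ulamInd_wordTwo_rec (x y : ℕ) (h : x + y ≠ 0) :
    ulamInd (wordTwo x y) =
      if (if x = 0 then 0 else ulamInd (wordTwo (x - 1) y)) +
        (if y = 0 then 0 else ulamInd (wordTwo x (y - 1))) = 1 then 1 else 0 := by
  rw [ulamInd_eq_ite_sum _ (x + y) (by simp [wordTwo]; omega) h, Finset.sum_range_add]
  have h1 := sum_pairInd_replicate_left x ([true] ++ List.replicate y false) (by simp)
  have h2 := sum_pairInd_replicate_right y x (List.replicate x false ++ [true]) (by simp)
    (by simp)
  simp only [← List.append_assoc] at h1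
  unfold wordTwo
  rw [h1, h2]

theorem ulamInd_wordTwo (x y : ℕ) : ulamInd (wordTwo x y) = choosePar x y := by
  obtain ⟨n, hn⟩ : ∃ n, x + y = n := ⟨_, rfl⟩
  induction n generalizing x y with
  | zero =>
    obtain ⟨rfl, rfl⟩ : x = 0 ∧ y = 0 := by omega
    simp [wordTwo, choosePar_zero_left, ulamInd, isUlam_singleton]
  | succ n ih =>
    rw [ulamInd_wordTwo_rec x y (by omega)]
    rcases x with _ | x <;> rcases y with _ | y
    · omega
    · simp [ih 0 y (by omega), choosePar_zero_left]
    · simp [ih x 0 (by omega), choosePar_zero_right]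
    · simp only [Nat.add_eq_zero_iff, one_ne_zero, and_false, if_false, Nat.add_sub_cancel,
        ih x (y + 1) (by omega), ih (x + 1) y (by omega), choosePar_succ_succ]
      have := choosePar_le_one x (y + 1)
      have := choosePar_le_one (x + 1) y
      split_ifs <;> omega

theorem wordTwo_inj {x y x' y' : ℕ} : wordTwo x y = wordTwo x' y' ↔ x = x' ∧ y = y' := by
  constructor
  · intro h
    have h1 := congrArg (List.idxOf true) h
    have h2 := congrArg List.length h
    have e : ∀ a b : ℕ, (wordTwo a b).idxOf true = a := by
      intro a b
      simp [wordTwo, List.idxOf_append]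
    rw [e, e] at h1
    simp [wordTwo] at h2
    omega
  · rintro ⟨rfl, rfl⟩; rfl

/-- The number of decompositions of `0^x 1 0^y 1 0^z` into two distinct Ulam words
each having a single `1`. -/
noncomputable def midCount (y x z : ℕ) : ℕ :=
  ∑ a ∈ Finset.range (y + 1), pairInd (wordTwo x a) (wordTwo (y - a) z)

theorem midCount_add (y x z : ℕ) :
    midCount y x z + (if x + z = y ∧ choosePar x z = 1 then 1 else 0) = numSplits y x z := by
  have key : ∀ a ∈ Finset.range (y + 1), choosePar x a * choosePar (y - a) z =
      pairInd (wordTwo x a) (wordTwo (y - a) z) +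
        if a = z then (if x + z = y ∧ choosePar x z = 1 then 1 else 0) else 0 := by
    intro a ha
    have ha : a < y + 1 := by simpa using ha
    unfold pairInd
    simp only [wordTwo_inj, ulamInd_wordTwo]
    have h1 := choosePar_le_one x z
    by_cases haz : a = z
    · subst haz
      by_cases hy : x + a = y
      · subst hy
        interval_cases h : choosePar x a <;> simp [h]
      · simp [hy, show ¬ x = y - a by omega]
    · simp [haz]
  rw [numSplits, Finset.sum_congr rfl key, Finset.sum_add_distrib, midCount,
    Finset.sum_ite_eq']
  congr 1
  split_ifs with h1 h2 h3 <;> first | rfl | (simp at h2; omega)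

theorem ulamInd_wordThree_rec (x y z : ℕ) :
    ulamInd (wordThree x y z) =
      if (if x = 0 then 0 else ulamInd (wordThree (x - 1) y z)) + midCount y x z +
        (if z = 0 then 0 else ulamInd (wordThree x y (z - 1))) = 1 then 1 else 0 := by
  rw [ulamInd_eq_ite_sum _ (x + (y + 1) + z) (by simp [wordThree]; omega) (by omega),
    Finset.sum_range_add, Finset.sum_range_add]
  have h1 := sum_pairInd_replicate_left x
    ([true] ++ List.replicate y false ++ [true] ++ List.replicate z false) (by simp)
  have h2 := sum_pairInd_replicate_right z (x + (y + 1))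
    (List.replicate x false ++ [true] ++ List.replicate y false ++ [true]) (by simp)
    (by simp; omega)
  have h3 : ∑ i ∈ Finset.range (y + 1), pairInd ((wordThree x y z).take (x + i + 1))
      ((wordThree x y z).drop (x + i + 1)) = midCount y x z := by
    refine Finset.sum_congr rfl fun i hi => ?_
    have hi : i < y + 1 := by simpa using hi
    refine pairInd_take_drop ?_ (by simp [wordTwo]; omega)
    obtain ⟨j, rfl⟩ : ∃ j, y = i + j := ⟨y - i, by omega⟩
    simp only [wordTwo, wordThree, List.replicate_add, Nat.add_sub_cancel_left,
      List.append_assoc]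
  rw [h3]
  simp only [← List.append_assoc] at h1
  unfold wordThree
  rw [h1, h2]

/-- The common indicator function of `UlamSet (2 * h)` and `UlamSet (2 * h + 1)`. -/
def patternInd (h x z : ℕ) : ℕ :=
  if (x + z) % 2 = 1 ∧ numSplits h (x / 2) (z / 2) = 1 then 1 else 0

theorem ulamInd_wordThree_eq_patternInd (h y : ℕ)
    (hodd : ∀ x z, (x + z) % 2 = 1 →
      (midCount y x z = 1 ↔ numSplits h (x / 2) (z / 2) = 1))
    (heven : ∀ x z, (x + z) % 2 = 0 → (if x = 0 then 0 else patternInd h (x - 1) z) +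
      midCount y x z + (if z = 0 then 0 else patternInd h x (z - 1)) ≠ 1) (x z : ℕ) :
    ulamInd (wordThree x y z) = patternInd h x z := by
  obtain ⟨n, hn⟩ : ∃ n, x + z = n := ⟨_, rfl⟩
  induction n using Nat.strong_induction_on generalizing x z with
  | _ n ih =>
  have hx : (if x = 0 then 0 else ulamInd (wordThree (x - 1) y z)) =
      if x = 0 then 0 else patternInd h (x - 1) z := by
    split_ifs
    · rfl
    · exact ih (x - 1 + z) (by omega) _ _ rfl
  have hz : (if z = 0 then 0 else ulamInd (wordThree x y (z - 1))) =
      if z = 0 then 0 else patternInd h x (z - 1) := by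
    split_ifs
    · rfl
    · exact ih (x + (z - 1)) (by omega) _ _ rfl
  rw [ulamInd_wordThree_rec, hx, hz]
  rcases Nat.mod_two_eq_zero_or_one (x + z) with h0 | h1
  · rw [if_neg (heven x z h0), patternInd, if_neg (by omega)]
  · have e1 : (if x = 0 then 0 else patternInd h (x - 1) z) = 0 := by
      split_ifs
      · rfl
      · rw [patternInd, if_neg (by omega)]
    have e2 : (if z = 0 then 0 else patternInd h x (z - 1)) = 0 := by
      split_ifs
      · rfl
      · rw [patternInd, if_neg (by omega)]
    rw [e1, e2, patternInd]
    simp only [h1, true_and, zero_add, add_zero, hodd x z h1]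

theorem midCount_eq_numSplits_or (y x z : ℕ) (hy : 2 ≤ (Nat.bits y).count false) :
    midCount y x z = numSplits y x z ∨ (x + z = y ∧ 2 ≤ midCount y x z ∧ 3 ≤ numSplits y x z) := by
  have h1 := midCount_add y x z
  split_ifs at h1 with h
  · have := count_false_bits_lt_numSplits y x z h.1 h.2
    omega
  · exact Or.inl h1

theorem patternInd_even_odd (h a b : ℕ) :
    patternInd h (2 * a) (2 * b + 1) = if numSplits h a b = 1 then 1 else 0 := by
  rw [patternInd, show (2 * a + (2 * b + 1)) % 2 = 1 by omega, show 2 * a / 2 = a by omega,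
    show (2 * b + 1) / 2 = b by omega]
  simp

theorem patternInd_odd_even (h a b : ℕ) :
    patternInd h (2 * a + 1) (2 * b) = if numSplits h a b = 1 then 1 else 0 := by
  rw [patternInd, show (2 * a + 1 + 2 * b) % 2 = 1 by omega, show 2 * b / 2 = b by omega,
    show (2 * a + 1) / 2 = a by omega]
  simp

theorem ulamInd_wordThree_odd (h : ℕ) (hh : 2 ≤ (Nat.bits h).count false) (x z : ℕ) :
    ulamInd (wordThree x (2 * h + 1) z) = patternInd h x z := by
  have hy : 2 ≤ (Nat.bits (2 * h + 1)).count false := by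
    rwa [Nat.bit1_bits, List.count_cons_of_ne (by simp)]
  refine ulamInd_wordThree_eq_patternInd h _ (fun x z hxz => ?_) (fun x z hxz => ?_) x z
  · have hm := midCount_eq_numSplits_or _ x z hy
    obtain ⟨a, rfl | rfl⟩ : ∃ a, x = 2 * a ∨ x = 2 * a + 1 := ⟨x / 2, by omega⟩ <;>
    obtain ⟨b, rfl | rfl⟩ : ∃ b, z = 2 * b ∨ z = 2 * b + 1 := ⟨z / 2, by omega⟩
    · omega
    · rw [numSplits_odd_even_odd] at hm
      rw [show 2 * a / 2 = a by omega, show (2 * b + 1) / 2 = b by omega]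
      omega
    · rw [numSplits_odd_odd_even] at hm
      rw [show (2 * a + 1) / 2 = a by omega, show 2 * b / 2 = b by omega]
      omega
    · omega
  · have hm : midCount (2 * h + 1) x z = numSplits (2 * h + 1) x z := by
      rcases midCount_eq_numSplits_or _ x z hy with h1 | h1
      · exact h1
      · omega
    rw [hm]
    obtain ⟨a, rfl | rfl⟩ : ∃ a, x = 2 * a ∨ x = 2 * a + 1 := ⟨x / 2, by omega⟩ <;>
    obtain ⟨b, rfl | rfl⟩ : ∃ b, z = 2 * b ∨ z = 2 * b + 1 := ⟨z / 2, by omega⟩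
    · rw [numSplits_odd_even_even]
      by_cases h0 : numSplits h a b = 0
      · obtain ⟨h, rfl⟩ : ∃ h', h = h' + 1 := Nat.exists_eq_succ_of_ne_zero (by
          rintro rfl; simp [numSplits_zero] at h0)
        obtain ⟨a, rfl⟩ : ∃ a', a = a' + 1 := Nat.exists_eq_succ_of_ne_zero (by
          rintro rfl; have := numSplits_zero_left_pos (h + 1) b; omega)
        obtain ⟨b, rfl⟩ : ∃ b', b = b' + 1 := Nat.exists_eq_succ_of_ne_zero (by
          rintro rfl; have := numSplits_zero_right_pos (h + 1) (a + 1); omega)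
        have := numSplits_pred_of_eq_zero h a b h0
        rw [if_neg (by omega), if_neg (by omega), h0,
          show 2 * (a + 1) - 1 = 2 * a + 1 by omega, show 2 * (b + 1) - 1 = 2 * b + 1 by omega,
          patternInd_odd_even, patternInd_even_odd, ← this.1, ← this.2]
        split_ifs <;> omega
      · omega
    · omega
    · omega
    · rw [numSplits_odd_odd_odd, if_neg (by omega), if_neg (by omega), Nat.add_sub_cancel,
        Nat.add_sub_cancel, patternInd_even_odd, patternInd_odd_even]
      omega

theorem ulamInd_wordThree_even (h : ℕ) (hh : 2 ≤ (Nat.bits h).count false) (x z : ℕ) :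
    ulamInd (wordThree x (2 * h) z) = patternInd h x z := by
  obtain ⟨h, rfl⟩ : ∃ h', h = h' + 1 := Nat.exists_eq_succ_of_ne_zero (by
    rintro rfl; simp at hh)
  have hy : 2 ≤ (Nat.bits (2 * (h + 1))).count false := by
    rw [Nat.bit0_bits _ (by omega), List.count_cons_self]
    omega
  refine ulamInd_wordThree_eq_patternInd (h + 1) _ (fun x z hxz => ?_) (fun x z hxz => ?_) x z
  · have hm : midCount (2 * (h + 1)) x z = numSplits (2 * (h + 1)) x z := by
      rcases midCount_eq_numSplits_or _ x z hy with h1 | h1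
      · exact h1
      · omega
    rw [hm]
    obtain ⟨a, rfl | rfl⟩ : ∃ a, x = 2 * a ∨ x = 2 * a + 1 := ⟨x / 2, by omega⟩ <;>
    obtain ⟨b, rfl | rfl⟩ : ∃ b, z = 2 * b ∨ z = 2 * b + 1 := ⟨z / 2, by omega⟩
    · omega
    · rw [numSplits_even_even_odd, show 2 * a / 2 = a by omega,
        show (2 * b + 1) / 2 = b by omega]
    · rw [numSplits_even_odd_even, show (2 * a + 1) / 2 = a by omega,
        show 2 * b / 2 = b by omega]
    · omega
  · rcases midCount_eq_numSplits_or _ x z hy with hm | hm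
    swap
    · omega
    rw [hm]
    obtain ⟨a, rfl | rfl⟩ : ∃ a, x = 2 * a ∨ x = 2 * a + 1 := ⟨x / 2, by omega⟩ <;>
    obtain ⟨b, rfl | rfl⟩ : ∃ b, z = 2 * b ∨ z = 2 * b + 1 := ⟨z / 2, by omega⟩
    · rw [numSplits_even_even_even]
      by_cases h2 : 2 ≤ numSplits (h + 1) a b + numSplits h a b
      · omega
      obtain ⟨a, rfl⟩ : ∃ a', a = a' + 1 := Nat.exists_eq_succ_of_ne_zero (by
        rintro rfl
        have := numSplits_zero_left_pos (h + 1) b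
        have := numSplits_zero_left_pos h b
        omega)
      obtain ⟨b, rfl⟩ : ∃ b', b = b' + 1 := Nat.exists_eq_succ_of_ne_zero (by
        rintro rfl
        have := numSplits_zero_right_pos (h + 1) (a + 1)
        have := numSplits_zero_right_pos h (a + 1)
        omega)
      have h3 := numSplits_pred_of_eq_zero h a b
      have h4 := numSplits_eq_one_of_pred_eq_zero h a b
      rw [if_neg (by omega), if_neg (by omega),
        show 2 * (a + 1) - 1 = 2 * a + 1 by omega, show 2 * (b + 1) - 1 = 2 * b + 1 by omega,
        patternInd_odd_even, patternInd_even_odd]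
      split_ifs <;> omega
    · omega
    · omega
    · rw [numSplits_even_odd_odd, if_neg (by omega), if_neg (by omega), Nat.add_sub_cancel,
        Nat.add_sub_cancel, patternInd_even_odd, patternInd_odd_even]
      split_ifs <;> omega

/-- For odd positive non-Zumkeller `y`, `Ulam[y] = Ulam[y-1]`. -/
theorem ulamSet_odd_eq_pred (y : ℕ) (hy : 0 < y) (hodd : Odd y)
    (hzum : ¬ IsZumkeller y) :
    UlamSet y = UlamSet (y - 1) := by
  obtain ⟨h, rfl⟩ := hodd
  have hh : 2 ≤ (Nat.bits h).count false := by
    simp only [IsZumkeller, hy, true_and, Nat.bit1_bits] at hzum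
    rw [List.count_cons_of_ne (by simp)] at hzum
    omega
  ext ⟨x, z⟩
  simp only [UlamSet, Set.mem_ofPred_eq, Nat.add_sub_cancel, ← ulamInd_eq_one_iff,
    ulamInd_wordThree_odd h hh, ulamInd_wordThree_even h hh]
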